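/- Let d ≥ 1 be an odd integer, let h be a binomial random variable with parameters d and 1/2, and let Y = min(h, d − h). Then E[Y] = (d/2^d)·(2^{d−1} − binom(d−1, (d−1)/2)). -/

import Mathlib

/-- The number of heads among `d` fair coin flips `σ`. -/
def numHeads {d : ℕ} (σ : Fin d → Bool) : ℕ :=
  (Finset.univ.filter (fun j : Fin d => σ j = true)).card

/-- `minorityExp d` is the expectation of `Y = min(h, d−h)`, where `h` is a binomial
random variable with parameters `d` and `1/2` (the number of heads among `d`
independent fair coin flips). -/
noncomputable def minorityExp (d : ℕ) : ℝ :=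
  (∑ σ : Fin d → Bool, ((min (numHeads σ) (d - numHeads σ) : ℕ) : ℝ)) / 2 ^ d

/-- Summing a function of the number of heads over all outcomes of `d` coin flips. -/
theorem sum_apply_numHeads {M : Type*} [AddCommMonoid M] (d : ℕ) (f : ℕ → M) :
    ∑ σ : Fin d → Bool, f (numHeads σ) = ∑ k ∈ Finset.range (d + 1), d.choose k • f k := by
  have h := Finset.sum_powerset_apply_card f (x := (Finset.univ : Finset (Fin d)))
  rw [Finset.powerset_univ, Finset.card_fin] at h
  rw [← h]
  refine Finset.sum_bij' (fun σ _ => Finset.univ.filter (fun j => σ j = true))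
    (fun s _ j => decide (j ∈ s)) ?_ ?_ ?_ ?_ ?_ <;> intros <;> first | rfl | (ext; simp) | simp

/-- The row `2 * m` of Pascal's triangle splits into two equal halves and a central term. -/
theorem two_mul_sum_range_choose_add_centralBinom (m : ℕ) :
    2 * ∑ k ∈ Finset.range m, (2 * m).choose k + (2 * m).choose m = 2 ^ (2 * m) := by
  rw [← Nat.sum_range_choose (2 * m), show 2 * m + 1 = (m + 1) + m by ring,
    Finset.sum_range_add, Finset.sum_range_succ, two_mul (∑ k ∈ _, _)]
  have h : ∑ x ∈ Finset.range m, (2 * m).choose (m + 1 + x) =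
      ∑ k ∈ Finset.range m, (2 * m).choose k := by
    rw [← Finset.sum_range_reflect]
    refine Finset.sum_congr rfl fun k hk => ?_
    rw [Finset.mem_range] at hk
    exact Nat.choose_symm_of_eq_add (by omega)
  rw [h]
  ring

/-- The minority sum over an odd row of Pascal's triangle folds onto its first half. -/
theorem sum_range_choose_mul_min (m : ℕ) :
    ∑ k ∈ Finset.range (2 * m + 2), (2 * m + 1).choose k * min k (2 * m + 1 - k) =
      2 * ((2 * m + 1) * ∑ k ∈ Finset.range m, (2 * m).choose k) := by
  have first_half : ∑ k ∈ Finset.range (m + 1), (2 * m + 1).choose k * min k (2 * m + 1 - k) =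
      (2 * m + 1) * ∑ k ∈ Finset.range m, (2 * m).choose k := by
    rw [Finset.sum_range_succ', Finset.mul_sum, Nat.zero_min, mul_zero, add_zero]
    refine Finset.sum_congr rfl fun k hk => ?_
    rw [Finset.mem_range] at hk
    rw [min_eq_left (by omega), Nat.add_one_mul_choose_eq]
  have second_half : ∑ k ∈ Finset.range (m + 1),
      (2 * m + 1).choose (m + 1 + k) * min (m + 1 + k) (2 * m + 1 - (m + 1 + k)) =
      ∑ k ∈ Finset.range (m + 1), (2 * m + 1).choose k * min k (2 * m + 1 - k) := by
    rw [← Finset.sum_range_reflect]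
    refine Finset.sum_congr rfl fun k hk => ?_
    rw [Finset.mem_range] at hk
    rw [Nat.choose_symm_of_eq_add (n := 2 * m + 1) (a := m + 1 + (m + 1 - 1 - k)) (b := k)
      (by omega)]
    congr 1
    omega
  rw [show 2 * m + 2 = (m + 1) + (m + 1) by ring, Finset.sum_range_add, second_half, first_half,
    two_mul ((2 * m + 1) * _)]

/-- For odd `d ≥ 1`, `E[Y] = (d/2^d)·(2^{d−1} − C(d−1, (d−1)/2))` where `Y = min(h, d−h)`
and `h ~ Bin(d, 1/2)`. -/
theorem minority_expectation_odd (d : ℕ) (hd : 1 ≤ d) (hodd : Odd d) :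
    minorityExp d =
      ((d : ℝ) / 2 ^ d) * (2 ^ (d - 1) - ((d - 1).choose ((d - 1) / 2) : ℝ)) := by
  obtain ⟨m, rfl⟩ := hodd
  rw [minorityExp, ← Nat.cast_sum,
    sum_apply_numHeads (2 * m + 1) (fun k => min k (2 * m + 1 - k))]
  simp only [smul_eq_mul]
  rw [sum_range_choose_mul_min, Nat.add_sub_cancel, Nat.mul_div_cancel_left m two_pos]
  have h : (2 : ℝ) * (∑ k ∈ Finset.range m, (2 * m).choose k : ℕ) + (2 * m).choose m =
      2 ^ (2 * m) := mod_cast two_mul_sum_range_choose_add_centralBinom m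
  rw [← h]
  push_cast
  ring
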